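/- For every level k > 2, the total odd interval length satisfies the upper bound I_k^(o) <= 2/(k+1) + sum_{j=1}^{k-2} I_{k-j}^(e) * 3/(2j+3). -/

import Mathlib

/-- Numerators of the modified Farey sequence: at level `k`, order `n` (1-indexed,
`n = 1, …, 2^k + 1`). Level 0 is `0/1, 1/1`; odd orders at level `k+1` are carried
over from level `k`, even orders are mediants. -/
def fareyNum : ℕ → ℕ → ℕ
  | 0, n => if n = 1 then 0 else 1
  | k + 1, m =>
      if m % 2 = 1 then fareyNum k ((m + 1) / 2)
      else fareyNum k (m / 2) + fareyNum k (m / 2 + 1)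

/-- Denominators of the modified Farey sequence. -/
def fareyDen : ℕ → ℕ → ℕ
  | 0, _ => 1
  | k + 1, m =>
      if m % 2 = 1 then fareyDen k ((m + 1) / 2)
      else fareyDen k (m / 2) + fareyDen k (m / 2 + 1)

/-- The Farey fraction `r_k^(n) = n_k^(n) / d_k^(n)` as a real number. -/
noncomputable def fareyR (k n : ℕ) : ℝ := (fareyNum k n : ℝ) / (fareyDen k n : ℝ)

/-- The interval `I_k^(n)`: for `n ≥ 2` it is `r_k^(2n) - r_k^(2n-2)`, and
`I_k^(1) := 2/(k+1)`. -/
noncomputable def fareyI (k n : ℕ) : ℝ :=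
  if n = 1 then 2 / ((k : ℝ) + 1) else fareyR k (2 * n) - fareyR k (2 * n - 2)

/-- Total length of even intervals at level `k`. -/
noncomputable def fareyIe (k : ℕ) : ℝ :=
  ∑ i ∈ Finset.Icc 1 (2 ^ (k - 2)), fareyI k (2 * i)

/-- Total length of odd intervals at level `k`. -/
noncomputable def fareyIo (k : ℕ) : ℝ :=
  ∑ i ∈ Finset.Icc 1 (2 ^ (k - 2)), fareyI k (2 * i - 1)

/-- `S_k`: the sum of inverse squares of the new denominators at level `k`. -/
noncomputable def fareyS (k : ℕ) : ℝ :=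
  ∑ n ∈ Finset.Icc 1 (2 ^ (k - 1)), 1 / (fareyDen k (2 * n) : ℝ) ^ 2

theorem fareyNum_succ_odd (k n : ℕ) : fareyNum (k + 1) (2 * n + 1) = fareyNum k (n + 1) := by
  rw [fareyNum, if_pos (by omega), show (2 * n + 1 + 1) / 2 = n + 1 by omega]

theorem fareyNum_succ_even (k n : ℕ) :
    fareyNum (k + 1) (2 * n) = fareyNum k n + fareyNum k (n + 1) := by
  rw [fareyNum, if_neg (by omega), show 2 * n / 2 = n by omega]

theorem fareyDen_succ_odd (k n : ℕ) : fareyDen (k + 1) (2 * n + 1) = fareyDen k (n + 1) := by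
  rw [fareyDen, if_pos (by omega), show (2 * n + 1 + 1) / 2 = n + 1 by omega]

theorem fareyDen_succ_even (k n : ℕ) :
    fareyDen (k + 1) (2 * n) = fareyDen k n + fareyDen k (n + 1) := by
  rw [fareyDen, if_neg (by omega), show 2 * n / 2 = n by omega]

theorem fareyDen_pos (k n : ℕ) : 0 < fareyDen k n := by
  induction k generalizing n with
  | zero => simp [fareyDen]
  | succ k ih =>
    obtain ⟨m, rfl | rfl⟩ := n.even_or_odd'
    · rw [fareyDen_succ_even]
      exact Nat.add_pos_left (ih _) _
    · rw [fareyDen_succ_odd]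
      exact ih _

/-- Consecutive Farey fractions are unimodular. -/
theorem fareyNum_mul_fareyDen (k n : ℕ) (hn : n < 2 ^ k) :
    fareyNum k (n + 2) * fareyDen k (n + 1) = fareyNum k (n + 1) * fareyDen k (n + 2) + 1 := by
  induction k generalizing n with
  | zero =>
    obtain rfl : n = 0 := by simpa using hn
    simp [fareyNum, fareyDen]
  | succ k ih =>
    rw [pow_succ] at hn
    obtain ⟨m, rfl | rfl⟩ := n.even_or_odd'
    · have h := ih m (by omega)
      rw [show 2 * m + 2 = 2 * (m + 1) by ring, fareyNum_succ_even, fareyDen_succ_even,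
        fareyNum_succ_odd, fareyDen_succ_odd]
      linarith
    · have h := ih m (by omega)
      rw [show 2 * m + 1 + 2 = 2 * (m + 1) + 1 by ring, show 2 * m + 1 + 1 = 2 * (m + 1) by ring,
        fareyNum_succ_even, fareyDen_succ_even, fareyNum_succ_odd, fareyDen_succ_odd]
      linarith

/-- In a Farey-type array, the entry inserted between orders `t + 1` and `t + 2` of level `q`
and its two neighbours, `j` levels after the insertion. -/
theorem mediant_neighbours {u : ℕ → ℕ → ℕ}
    (hodd : ∀ k n, u (k + 1) (2 * n + 1) = u k (n + 1))
    (heven : ∀ k n, u (k + 1) (2 * n) = u k n + u k (n + 1)) (q t j : ℕ) :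
    u (q + 1 + j) (2 ^ j * (2 * t + 1)) = u q (t + 1) + j * (u q (t + 1) + u q (t + 2)) ∧
    u (q + 1 + j) (2 ^ j * (2 * t + 1) + 1) = u q (t + 1) + u q (t + 2) ∧
    u (q + 1 + j) (2 ^ j * (2 * t + 1) + 2) =
      u q (t + 2) + j * (u q (t + 1) + u q (t + 2)) := by
  induction j with
  | zero =>
    refine ⟨by simp [hodd], ?_, ?_⟩
    · simpa [show 2 * t + 1 + 1 = 2 * (t + 1) by ring] using heven q (t + 1)
    · simpa [show 2 * t + 1 + 2 = 2 * (t + 1) + 1 by ring] using hodd q (t + 1)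
  | succ j ih =>
    obtain ⟨h₀, h₁, h₂⟩ := ih
    set M := 2 ^ j * (2 * t + 1) with hM
    rw [show 2 ^ (j + 1) * (2 * t + 1) = 2 * M by rw [hM]; ring,
      show 2 * M + 2 = 2 * (M + 1) by ring, ← add_assoc, heven, hodd, heven, h₀, h₁, h₂]
    refine ⟨by ring, rfl, by ring⟩

/-- The interval around the fraction inserted between orders `t + 1` and `t + 2` of level `q`,
`j` levels after it first appears as an even interval. -/
theorem fareyI_descendant (q t j : ℕ) (ht : t < 2 ^ q) :
    fareyI (q + 2 + j) (2 ^ j * (2 * t + 1) + 1) =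
      (2 * j + 3) /
        ((fareyDen q (t + 1) + (j + 1) * (fareyDen q (t + 1) + fareyDen q (t + 2))) *
          (fareyDen q (t + 2) + (j + 1) * (fareyDen q (t + 1) + fareyDen q (t + 2)))) := by
  have hne : 2 ^ j * (2 * t + 1) + 1 ≠ 1 := by simp
  obtain ⟨n₀, -, n₂⟩ := mediant_neighbours fareyNum_succ_odd fareyNum_succ_even q t (j + 1)
  obtain ⟨d₀, -, d₂⟩ := mediant_neighbours fareyDen_succ_odd fareyDen_succ_even q t (j + 1)
  have hdet : (fareyNum q (t + 2) * fareyDen q (t + 1) : ℝ) =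
      fareyNum q (t + 1) * fareyDen q (t + 2) + 1 := mod_cast fareyNum_mul_fareyDen q t ht
  have ha : (0 : ℝ) < fareyDen q (t + 1) := mod_cast fareyDen_pos q (t + 1)
  have hb : (0 : ℝ) < fareyDen q (t + 2) := mod_cast fareyDen_pos q (t + 2)
  rw [fareyI, if_neg hne, show q + 2 + j = q + 1 + (j + 1) by ring,
    show 2 * (2 ^ j * (2 * t + 1) + 1) - 2 = 2 ^ (j + 1) * (2 * t + 1) by
      rw [pow_succ, mul_add, Nat.add_sub_cancel]; ring,
    show 2 * (2 ^ j * (2 * t + 1) + 1) = 2 ^ (j + 1) * (2 * t + 1) + 2 by ring,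
    fareyR, fareyR, n₀, n₂, d₀, d₂]
  push_cast
  rw [div_sub_div _ _ (by positivity) (by positivity), mul_comm (_ + _ : ℝ) (fareyDen q (t + 2) + _)]
  congr 1
  linear_combination (2 * (j : ℝ) + 3) * hdet

theorem fareyI_descendant_le (q t j : ℕ) (ht : t < 2 ^ q) :
    fareyI (q + 2 + j) (2 ^ j * (2 * t + 1) + 1) ≤
      fareyI (q + 2) (2 * (t + 1)) * 3 / (2 * (j : ℝ) + 3) := by
  have h₀ := fareyI_descendant q t 0 ht
  rw [show 2 ^ 0 * (2 * t + 1) + 1 = 2 * (t + 1) by ring, add_zero] at h₀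
  rw [fareyI_descendant q t j ht, h₀]
  have ha : (0 : ℝ) < fareyDen q (t + 1) := mod_cast fareyDen_pos q (t + 1)
  have hb : (0 : ℝ) < fareyDen q (t + 2) := mod_cast fareyDen_pos q (t + 2)
  generalize (fareyDen q (t + 1) : ℝ) = a at *
  generalize (fareyDen q (t + 2) : ℝ) = b at *
  have hj : (0 : ℝ) ≤ j := j.cast_nonneg
  push_cast
  rw [div_mul_eq_mul_div, div_div, div_le_div_iff₀ (by positivity) (by positivity)]
  have : 0 ≤ ((j : ℝ) ^ 2 + 3 * j) * (a - b) ^ 2 := by positivity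
  linarith

/-- Splitting the indices below `2 ^ m` by their 2-adic valuation. -/
theorem sum_range_two_pow {A : Type*} [AddCommMonoid A] (m : ℕ) (g : ℕ → A) :
    ∑ n ∈ Finset.range (2 ^ m), g n =
      g 0 + ∑ j ∈ Finset.range m, ∑ i ∈ Finset.range (2 ^ (m - 1 - j)),
        g (2 ^ j * (2 * i + 1)) := by
  have split : ∀ (g : ℕ → A) (N : ℕ), ∑ n ∈ Finset.range (2 * N), g n =
      ∑ n ∈ Finset.range N, g (2 * n) + ∑ n ∈ Finset.range N, g (2 * n + 1) := by
    intro g N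
    induction N with
    | zero => simp
    | succ N ih =>
      rw [show 2 * (N + 1) = 2 * N + 1 + 1 by ring, Finset.sum_range_succ, Finset.sum_range_succ,
        ih, Finset.sum_range_succ, Finset.sum_range_succ]
      abel
  induction m generalizing g with
  | zero => simp
  | succ m ih =>
    rw [pow_succ', split, ih (fun n => g (2 * n)), Finset.sum_range_succ', ← add_assoc]
    congr 1
    · congr 1
      refine Finset.sum_congr rfl fun j _ => ?_
      rw [show m + 1 - 1 - (j + 1) = m - 1 - j by omega]
      exact Finset.sum_congr rfl fun i _ => by rw [pow_succ', mul_assoc]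
    · simp

/-- Upper bound for the total odd interval length, for `k > 2`. -/
theorem fareyIo_upper_bound (k : ℕ) (hk : 2 < k) :
    fareyIo k ≤
      2 / ((k : ℝ) + 1) +
        ∑ j ∈ Finset.Icc 1 (k - 2), fareyIe (k - j) * 3 / (2 * (j : ℝ) + 3) := by
  have shift : ∀ (N : ℕ) (f : ℕ → ℝ),
      ∑ i ∈ Finset.Icc 1 N, f i = ∑ i ∈ Finset.range N, f (i + 1) := fun N f => by
    rw [Finset.range_eq_Ico, Finset.sum_Ico_add' f 0 N 1]
    rfl
  rw [fareyIo, shift, shift, sum_range_two_pow]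
  gcongr with j hj
  · simp [fareyI]
  · rw [Finset.mem_range] at hj
    rw [fareyIe, shift, Finset.sum_mul, Finset.sum_div,
      show k - 2 - 1 - j = k - (j + 1) - 2 by omega]
    refine Finset.sum_le_sum fun i hi => ?_
    have h := fareyI_descendant_le (k - (j + 1) - 2) i (j + 1) (Finset.mem_range.mp hi)
    rw [show k - (j + 1) - 2 + 2 = k - (j + 1) by omega,
      show k - (j + 1) + (j + 1) = k by omega] at h
    rwa [show 2 * (2 ^ j * (2 * i + 1) + 1) - 1 = 2 ^ (j + 1) * (2 * i + 1) + 1 by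
      rw [pow_succ', mul_assoc]; omega]
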